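/- For any function u on Z^2 × R (components u_p : R → C) and any interval I, the nonlinear estimate Σ_{j∈Z^2} ⟨j⟩^2 (Σ_{(p1,...,p5)∈R(j)} Π_{k=1}^5 ‖u_{p_k}‖_{L^6_{x,t}(R×I)})^2 ≤ C (Σ_{p∈Z^2} ⟨p⟩^2 ‖u_p‖_{L^6_{x,t}(R×I)}^2)^5 holds with an absolute constant C. -/

import Mathlib

open MeasureTheory
open scoped ENNReal

/-- Quintuples of points of `ℤ²`. -/
abbrev Quint : Type := (ℤ × ℤ) × (ℤ × ℤ) × (ℤ × ℤ) × (ℤ × ℤ) × (ℤ × ℤ)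

/-- Squared Euclidean norm on `ℤ²`. -/
def nsqZ (p : ℤ × ℤ) : ℤ := p.1 ^ 2 + p.2 ^ 2

/-- The resonance conditions defining the set `𝓡(j)`. -/
def isRes (j : ℤ × ℤ) (v : Quint) : Prop :=
  v.1 - v.2.1 + v.2.2.1 - v.2.2.2.1 + v.2.2.2.2 = j ∧
  nsqZ v.1 - nsqZ v.2.1 + nsqZ v.2.2.1 - nsqZ v.2.2.2.1 + nsqZ v.2.2.2.2 = nsqZ j

/-- The space-time `L⁶` norm on `ℝ_x × I`. -/
noncomputable def L6 (I : Set ℝ) (f : ℝ × ℝ → ℂ) : ℝ≥0∞ :=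
  eLpNorm f 6 ((volume : Measure (ℝ × ℝ)).restrict (Set.univ ×ˢ I))

/-- The weight `⟨p⟩² = 1 + |p|²`. -/
noncomputable def jw (p : ℤ × ℤ) : ℝ≥0∞ := ENNReal.ofReal (1 + (nsqZ p : ℝ))

theorem tsum_prod_any {α β : Type*} (F : α × β → ℝ≥0∞) :
    (∑' p, F p) = ∑' a, ∑' b, F (a, b) :=
  ENNReal.tsum_prod (f := fun a b => F (a, b))

/-- one-dimensional weight -/
noncomputable def qw (x : ℤ) : ℝ≥0∞ := ENNReal.ofReal ((1 + (x : ℝ) ^ 2) ^ (-(9 / 16) : ℝ))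

theorem qw_sum : (∑' x : ℤ, qw x) ≠ ⊤ := by
  have h1 : Summable fun n : ℤ => |(n : ℝ)| ^ (-(9 / 8) : ℝ) :=
    Real.summable_abs_int_rpow (by norm_num)
  have h2 : Summable fun n : ℤ => (if n = 0 then (1 : ℝ) else 0) :=
    summable_of_ne_finset_zero (s := {0}) (by intro b hb; simp at hb; simp [hb])
  have h3 : Summable fun x : ℤ => ((1 + (x : ℝ) ^ 2) ^ (-(9 / 16) : ℝ)) := by
    refine Summable.of_nonneg_of_le (fun x => by positivity) (fun x => ?_) (h1.add h2)
    by_cases hx : x = 0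
    · subst hx
      simp
    · simp only [hx, if_false, add_zero]
      have hx' : (0 : ℝ) < |(x : ℝ)| := by positivity
      have : |(x : ℝ)| ^ (-(9 / 8) : ℝ) = (|(x : ℝ)| ^ 2) ^ (-(9 / 16) : ℝ) := by
        rw [← Real.rpow_natCast, ← Real.rpow_mul hx'.le]
        norm_num
      rw [this, sq_abs]
      apply Real.rpow_le_rpow_of_nonpos (by positivity) (by linarith) (by norm_num)
  exact h3.tsum_ofReal_ne_top

theorem nsqZ_nonneg (p : ℤ × ℤ) : (0 : ℝ) ≤ (nsqZ p : ℝ) := by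
  unfold nsqZ; push_cast; positivity

theorem one_le_jw (p : ℤ × ℤ) : 1 ≤ jw p := by
  unfold jw
  rw [ENNReal.one_le_ofReal]
  linarith [nsqZ_nonneg p]

theorem jw_ne_top (p : ℤ × ℤ) : jw p ≠ ⊤ := ENNReal.ofReal_ne_top

theorem jw_ne_zero (p : ℤ × ℤ) : jw p ≠ 0 := (lt_of_lt_of_le one_pos (one_le_jw p)).ne'

theorem jw_rpow (p : ℤ × ℤ) (a : ℝ) : jw p ^ a = ENNReal.ofReal ((1 + (nsqZ p : ℝ)) ^ a) := by
  unfold jw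
  rw [ENNReal.ofReal_rpow_of_pos (by linarith [nsqZ_nonneg p])]

theorem k_le_fst (p : ℤ × ℤ) : jw p ^ (-(5 / 8) : ℝ) ≤ qw p.1 := by
  rw [jw_rpow, qw]
  apply ENNReal.ofReal_le_ofReal
  refine (Real.rpow_le_rpow_of_exponent_le (by linarith [nsqZ_nonneg p])
    (by norm_num : (-(5 / 8) : ℝ) ≤ -(9 / 16))).trans ?_
  apply Real.rpow_le_rpow_of_nonpos (by positivity) _ (by norm_num)
  unfold nsqZ; push_cast; nlinarith [sq_nonneg (p.2 : ℝ)]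

theorem k_le_snd (p : ℤ × ℤ) : jw p ^ (-(5 / 8) : ℝ) ≤ qw p.2 := by
  rw [jw_rpow, qw]
  apply ENNReal.ofReal_le_ofReal
  refine (Real.rpow_le_rpow_of_exponent_le (by linarith [nsqZ_nonneg p])
    (by norm_num : (-(5 / 8) : ℝ) ≤ -(9 / 16))).trans ?_
  apply Real.rpow_le_rpow_of_nonpos (by positivity) _ (by norm_num)
  unfold nsqZ; push_cast; nlinarith [sq_nonneg (p.1 : ℝ)]

theorem h_le (p : ℤ × ℤ) : jw p ^ (-(9 / 8) : ℝ) ≤ qw p.1 * qw p.2 := by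
  rw [jw_rpow, qw, qw, ← ENNReal.ofReal_mul (by positivity)]
  apply ENNReal.ofReal_le_ofReal
  rw [← Real.mul_rpow (by positivity) (by positivity)]
  have h0 : (0 : ℝ) ≤ 1 + (nsqZ p : ℝ) := by linarith [nsqZ_nonneg p]
  have : (1 + (nsqZ p : ℝ)) ^ (-(9 / 8) : ℝ) = ((1 + (nsqZ p : ℝ)) ^ 2) ^ (-(9 / 16) : ℝ) := by
    rw [← Real.rpow_natCast, ← Real.rpow_mul h0]
    norm_num
  rw [this]
  apply Real.rpow_le_rpow_of_nonpos (by positivity) _ (by norm_num)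
  unfold nsqZ; push_cast
  nlinarith [sq_nonneg (p.1 : ℝ), sq_nonneg (p.2 : ℝ),
    mul_nonneg (sq_nonneg (p.1 : ℝ)) (sq_nonneg (p.2 : ℝ)), sq_nonneg ((p.1 : ℝ) ^ 2), sq_nonneg ((p.2 : ℝ) ^ 2)]

theorem h_sum : (∑' p : ℤ × ℤ, jw p ^ (-(9 / 8) : ℝ)) ≠ ⊤ := by
  refine ne_top_of_le_ne_top ?_ (ENNReal.tsum_le_tsum h_le)
  rw [tsum_prod_any]
  simp only [ENNReal.tsum_mul_left, ENNReal.tsum_mul_right]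
  exact ENNReal.mul_ne_top qw_sum qw_sum

theorem gg_le_h (p : ℤ × ℤ) : (jw p)⁻¹ * (jw p)⁻¹ ≤ jw p ^ (-(9 / 8) : ℝ) := by
  rw [← ENNReal.rpow_neg_one, ← ENNReal.rpow_add _ _ (jw_ne_zero p) (jw_ne_top p)]
  exact ENNReal.rpow_le_rpow_of_exponent_le (one_le_jw p) (by norm_num)

open Classical in
theorem two_count (T : ℤ → Prop) (b : ℤ) (hT : ∀ x y, T x → T y → x = y ∨ x + y = b) :
    (∑' y : ℤ, if T y then (1 : ℝ≥0∞) else 0) ≤ 2 := by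
  by_cases h : ∃ a, T a
  · obtain ⟨a, ha⟩ := h
    calc (∑' y : ℤ, if T y then (1 : ℝ≥0∞) else 0)
        ≤ ∑' y : ℤ, ((if y = a then (1 : ℝ≥0∞) else 0) + (if y = b - a then 1 else 0)) := by
          apply ENNReal.tsum_le_tsum
          intro y
          by_cases hy : T y
          · rcases hT y a hy ha with h | h
            · simp [h, ha]
            · have : y = b - a := by omega
              simp only [if_pos hy, if_pos this]
              exact le_add_self
          · simp [hy]
      _ = 2 := by
          rw [ENNReal.tsum_add, tsum_ite_eq, tsum_ite_eq]; norm_num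
  · push Not at h
    simp [h]

open Classical in
theorem thin_fst (S : ℤ × ℤ → Prop) (b : ℤ) (hT : ∀ x y z, S (x, y) → S (x, z) → y = z ∨ y + z = b) :
    (∑' p : ℤ × ℤ, if S p then jw p ^ (-(5 / 8) : ℝ) else 0) ≤ 2 * ∑' x, qw x := by
  calc (∑' p : ℤ × ℤ, if S p then jw p ^ (-(5 / 8) : ℝ) else 0)
      ≤ ∑' p : ℤ × ℤ, qw p.1 * (if S p then 1 else 0) := by
        apply ENNReal.tsum_le_tsum
        intro p
        by_cases h : S p
        · simpa [h] using k_le_fst p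
        · simp [h]
    _ = ∑' x, qw x * ∑' y, (if S (x, y) then 1 else 0) := by
        rw [tsum_prod_any]; simp only [ENNReal.tsum_mul_left]
    _ ≤ ∑' x, qw x * 2 := by
        apply ENNReal.tsum_le_tsum
        intro x
        gcongr
        exact two_count (fun y => S (x, y)) b (fun y z => hT x y z)
    _ = _ := by rw [ENNReal.tsum_mul_right, mul_comm]

open Classical in
theorem thin_snd (S : ℤ × ℤ → Prop) (b : ℤ) (hT : ∀ x y z, S (y, x) → S (z, x) → y = z ∨ y + z = b) :
    (∑' p : ℤ × ℤ, if S p then jw p ^ (-(5 / 8) : ℝ) else 0) ≤ 2 * ∑' x, qw x := by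
  calc (∑' p : ℤ × ℤ, if S p then jw p ^ (-(5 / 8) : ℝ) else 0)
      ≤ ∑' p : ℤ × ℤ, qw p.2 * (if S p then 1 else 0) := by
        apply ENNReal.tsum_le_tsum
        intro p
        by_cases h : S p
        · simpa [h] using k_le_snd p
        · simp [h]
    _ = ∑' x, qw x * ∑' y, (if S (y, x) then 1 else 0) := by
        rw [tsum_prod_any, ENNReal.tsum_comm]; simp only [ENNReal.tsum_mul_left]
    _ ≤ ∑' x, qw x * 2 := by
        apply ENNReal.tsum_le_tsum
        intro x
        gcongr
        exact two_count (fun y => S (y, x)) b (fun y z => hT x y z)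
    _ = _ := by rw [ENNReal.tsum_mul_right, mul_comm]

/-- the two-point slice of the resonant set -/
def slice (s t : ℤ) (c : ℤ × ℤ) (d : ℤ) (x y : ℤ × ℤ) : Prop :=
  s • x + t • y = c ∧ s * nsqZ x + t * nsqZ y = d ∧ (s + t = 0 → x ≠ y)

open Classical in
theorem slice_thin (s t : ℤ) (hs : s = 1 ∨ s = -1) (ht : t = 1 ∨ t = -1) (c : ℤ × ℤ) (d : ℤ) :
    (∑' p : ℤ × ℤ, if ∃ x, slice s t c d x p then jw p ^ (-(5 / 8) : ℝ) else 0)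
      ≤ 2 * ∑' x, qw x := by
  have key : ∀ x y : ℤ × ℤ, slice s t c d x y ↔
      (x.1 = s * (c.1 - t * y.1) ∧ x.2 = s * (c.2 - t * y.2)) ∧
        s * (x.1 ^ 2 + x.2 ^ 2) + t * (y.1 ^ 2 + y.2 ^ 2) = d ∧
        (s + t = 0 → ¬ (x.1 = y.1 ∧ x.2 = y.2)) := by
    intro x y
    unfold slice nsqZ
    simp only [Prod.ext_iff, Prod.fst_add, Prod.snd_add, Prod.smul_fst, Prod.smul_snd, smul_eq_mul,
      ne_eq]
    refine and_congr (and_congr ?_ ?_) Iff.rfl <;> rcases hs with rfl | rfl <;> omega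
  simp only [key]
  by_cases hst : s = t
  · subst hst
    apply thin_fst _ (s * c.2)
    rintro x y z ⟨⟨a, a'⟩, ⟨h1, h2⟩, h3, -⟩ ⟨⟨b, b'⟩, ⟨h4, h5⟩, h6, -⟩
    simp only at *
    subst h1 h2 h4 h5
    have : (y - z) * (y + z - s * c.2) = 0 := by
      rcases hs with rfl | rfl <;> linarith
    rcases mul_eq_zero.1 this with h | h
    · left; omega
    · right; omega
  · have hts : t = -s := by omega
    subst hts
    by_cases hc : c.2 = 0
    · by_cases hc1 : c.1 = 0
      · refine le_of_eq_of_le ?_ (zero_le (a := 2 * ∑' x, qw x))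
        rw [ENNReal.tsum_eq_zero]
        intro p
        rw [if_neg]
        rintro ⟨x, ⟨h1, h2⟩, -, h⟩
        apply h (by ring)
        rw [h1, h2, hc, hc1]
        rcases hs with rfl | rfl <;> constructor <;> ring
      · apply thin_snd _ 0
        rintro x y z ⟨⟨a, a'⟩, ⟨h1, h2⟩, h3, -⟩ ⟨⟨b, b'⟩, ⟨h4, h5⟩, h6, -⟩
        simp only at *
        subst h1 h2 h4 h5
        left
        have : c.1 * (y - z) = 0 := by
          rcases hs with rfl | rfl <;> linarith
        rcases mul_eq_zero.1 this with h | h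
        · exact absurd h hc1
        · omega
    · apply thin_fst _ 0
      rintro x y z ⟨⟨a, a'⟩, ⟨h1, h2⟩, h3, -⟩ ⟨⟨b, b'⟩, ⟨h4, h5⟩, h6, -⟩
      simp only at *
      subst h1 h2 h4 h5
      left
      have : c.2 * (y - z) = 0 := by
        rcases hs with rfl | rfl <;> linarith
      rcases mul_eq_zero.1 this with h | h
      · exact absurd h hc
      · omega

open Classical in
theorem slice_sum (s t : ℤ) (hs : s = 1 ∨ s = -1) (ht : t = 1 ∨ t = -1) (c : ℤ × ℤ) (d : ℤ) :
    (∑' x : ℤ × ℤ, ∑' y : ℤ × ℤ, if slice s t c d x y then jw y ^ (-(5 / 8) : ℝ) else 0)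
      ≤ 2 * ∑' x, qw x := by
  rw [ENNReal.tsum_comm]
  refine le_trans (ENNReal.tsum_le_tsum fun y => ?_) (slice_thin s t hs ht c d)
  by_cases h : ∃ x, slice s t c d x y
  · rw [if_pos h]
    obtain ⟨x0, hx0⟩ := h
    rw [tsum_eq_single x0, if_pos hx0]
    intro x hx
    rw [if_neg]
    intro hx'
    apply hx
    have := hx'.1.trans hx0.1.symm
    have h2 := add_right_cancel this
    have hs0 : s ≠ 0 := by omega
    exact smul_right_injective _ hs0 h2
  · push Not at h
    simp [h]

theorem tsum_pi_prod (f : ℤ × ℤ → ℝ≥0∞) (n : ℕ) :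
    (∑' v : Fin n → ℤ × ℤ, ∏ i, f (v i)) = (∑' p, f p) ^ n := by
  induction n with
  | zero => simp [tsum_fintype]
  | succ n ih =>
    rw [← (Fin.consEquiv (fun _ : Fin (n + 1) => ℤ × ℤ)).tsum_eq, tsum_prod_any]
    simp only [Fin.consEquiv, Equiv.coe_fn_mk, Fin.prod_univ_succ, Fin.cons_zero, Fin.cons_succ,
      ENNReal.tsum_mul_left, ENNReal.tsum_mul_right, ih]
    rw [pow_succ']

theorem tsum_cons2 (n : ℕ) (F : (Fin (n + 2) → ℤ × ℤ) → ℝ≥0∞) :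
    (∑' v, F v) = ∑' x : ℤ × ℤ, ∑' y : ℤ × ℤ, ∑' v : Fin n → ℤ × ℤ,
      F (Fin.cons x (Fin.cons y v : Fin (n + 1) → ℤ × ℤ)) := by
  rw [← (Fin.consEquiv (fun _ : Fin (n + 2) => ℤ × ℤ)).tsum_eq, tsum_prod_any]
  congr 1; ext x
  rw [← (Fin.consEquiv (fun _ : Fin (n + 1) => ℤ × ℤ)).tsum_eq, tsum_prod_any]
  rfl

/-- the resonance condition for general sign patterns -/
def Res {n : ℕ} (s : Fin n → ℤ) (j : ℤ × ℤ) (v : Fin n → ℤ × ℤ) : Prop :=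
  ∑ i, s i • v i = j ∧ ∑ i, s i * nsqZ (v i) = nsqZ j

open Classical in
/-- degenerate majorant -/
noncomputable def Dterm {n : ℕ} (s : Fin (n + 2) → ℤ) (j : ℤ × ℤ) (u : Fin (n + 2) → ℤ × ℤ) : ℝ≥0∞ :=
  if u 0 = u 1 ∧ Res (fun i : Fin n => s i.succ.succ) j (fun i => u i.succ.succ) then
    ((jw (u 0))⁻¹ * (jw (u 1))⁻¹) * (jw j * ∏ i : Fin n, (jw (u i.succ.succ))⁻¹) else 0

open Classical in
/-- non-degenerate majorant -/
noncomputable def Nterm {n : ℕ} (s : Fin (n + 2) → ℤ) (j : ℤ × ℤ) (u : Fin (n + 2) → ℤ × ℤ) : ℝ≥0∞ :=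
  if slice (s 0) (s 1) (j - ∑ i : Fin n, s i.succ.succ • u i.succ.succ)
      (nsqZ j - ∑ i : Fin n, s i.succ.succ * nsqZ (u i.succ.succ)) (u 0) (u 1) then
    ((n : ℝ≥0∞) + 2) ^ 2 * (jw (u 1) ^ (-(5 / 8) : ℝ) *
      ∏ i : Fin n, jw (u i.succ.succ) ^ (-(9 / 8) : ℝ)) else 0

/-- the uniform weighted counting bound -/
def CountBound (n : ℕ) (B : ℝ≥0∞) : Prop :=
  ∀ s : Fin n → ℤ, (∀ i, s i = 1 ∨ s i = -1) → ∀ j : ℤ × ℤ,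
    (∑' v : Fin n → ℤ × ℤ, {v | Res s j v}.indicator (fun v => jw j * ∏ i, (jw (v i))⁻¹) v) ≤ B

theorem D_sum {n : ℕ} (B : ℝ≥0∞) (hB : CountBound n B) (s : Fin (n + 2) → ℤ)
    (hs : ∀ i, s i = 1 ∨ s i = -1) (j : ℤ × ℤ) :
    (∑' u, Dterm s j u) ≤ (∑' p : ℤ × ℤ, jw p ^ (-(9 / 8) : ℝ)) * B := by
  classical
  rw [tsum_cons2]
  rw [← ENNReal.tsum_mul_right]
  apply ENNReal.tsum_le_tsum
  intro x
  rw [tsum_eq_single x]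
  · have : ∀ v : Fin n → ℤ × ℤ, Dterm s j (Fin.cons x (Fin.cons x v : Fin (n + 1) → ℤ × ℤ)) ≤
        jw x ^ (-(9 / 8) : ℝ) * {v | Res (fun i : Fin n => s i.succ.succ) j v}.indicator
          (fun v => jw j * ∏ i, (jw (v i))⁻¹) v := by
      intro v
      have e1 : (1 : Fin (n + 2)) = Fin.succ 0 := rfl
      simp only [Dterm, Fin.cons_zero, Fin.cons_succ, e1, true_and, Set.indicator, Set.mem_ofPred_eq]
      split_ifs
      · gcongr
        exact gg_le_h x
      · simp
    refine (ENNReal.tsum_le_tsum this).trans ?_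
    rw [ENNReal.tsum_mul_left]
    gcongr
    exact hB _ (fun i => hs _) j
  · intro y hy
    rw [ENNReal.tsum_eq_zero]
    intro v
    have e1 : (1 : Fin (n + 2)) = Fin.succ 0 := rfl
    simp only [Dterm, Fin.cons_zero, Fin.cons_succ, e1]
    rw [if_neg]
    exact fun h => hy h.1.symm

theorem N_sum {n : ℕ} (s : Fin (n + 2) → ℤ)
    (hs : ∀ i, s i = 1 ∨ s i = -1) (j : ℤ × ℤ) :
    (∑' u, Nterm s j u) ≤ ((n : ℝ≥0∞) + 2) ^ 2 * ((2 * ∑' x, qw x) *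
      (∑' p : ℤ × ℤ, jw p ^ (-(9 / 8) : ℝ)) ^ n) := by
  classical
  have e1 : (1 : Fin (n + 2)) = Fin.succ 0 := rfl
  rw [tsum_cons2]
  have h1 : ∀ F : ℤ × ℤ → ℤ × ℤ → (Fin n → ℤ × ℤ) → ℝ≥0∞,
      ∑' x, ∑' y, ∑' v, F x y v = ∑' v, ∑' x, ∑' y, F x y v := by
    intro F
    calc _ = ∑' x, ∑' v, ∑' y, F x y v := by
          congr 1; ext x; rw [ENNReal.tsum_comm]
      _ = _ := ENNReal.tsum_comm
  rw [h1, ← tsum_pi_prod, ← ENNReal.tsum_mul_left, ← ENNReal.tsum_mul_left]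
  apply ENNReal.tsum_le_tsum
  intro v
  have h2 : ∀ x y : ℤ × ℤ, Nterm s j (Fin.cons x (Fin.cons y v : Fin (n + 1) → ℤ × ℤ)) =
      (((n : ℝ≥0∞) + 2) ^ 2 * ∏ i : Fin n, jw (v i) ^ (-(9 / 8) : ℝ)) *
      (if slice (s 0) (s 1) (j - ∑ i : Fin n, s i.succ.succ • v i)
      (nsqZ j - ∑ i : Fin n, s i.succ.succ * nsqZ (v i)) x y then jw y ^ (-(5 / 8) : ℝ) else 0) := by
    intro x y
    simp only [Nterm, Fin.cons_zero, Fin.cons_succ, e1]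
    split_ifs
    · ring
    · simp
  simp only [h2, ENNReal.tsum_mul_left]
  calc _ ≤ (((n : ℝ≥0∞) + 2) ^ 2 * ∏ i : Fin n, jw (v i) ^ (-(9 / 8) : ℝ)) * (2 * ∑' x, qw x) := by
        gcongr
        exact slice_sum _ _ (hs _) (hs _) _ _
    _ = _ := by ring

theorem exists_perm {n : ℕ} (a b : Fin (n + 2)) (h : a ≠ b) :
    ∃ σ : Equiv.Perm (Fin (n + 2)), σ 0 = a ∧ σ 1 = b := by
  refine ⟨(Equiv.swap 1 (Equiv.swap 0 a b)).trans (Equiv.swap 0 a), ?_, ?_⟩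
  · have h1 : Equiv.swap 0 a b ≠ 0 := by
      intro h'
      have := congrArg (Equiv.swap 0 a) h'
      rw [← Equiv.trans_apply, Equiv.swap_swap, Equiv.refl_apply, Equiv.swap_apply_left] at this
      exact h this.symm
    have h01 : (0 : Fin (n + 2)) ≠ 1 := by simp
    rw [Equiv.trans_apply, Equiv.swap_apply_of_ne_of_ne h01 h1.symm, Equiv.swap_apply_left]
  · simp

theorem res_perm {n : ℕ} (s : Fin n → ℤ) (j : ℤ × ℤ) (v : Fin n → ℤ × ℤ)
    (σ : Equiv.Perm (Fin n)) (h : Res s j v) : Res (s ∘ σ) j (v ∘ σ) := by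
  refine ⟨?_, ?_⟩
  · rw [← h.1]; exact Equiv.sum_comp σ (fun i => s i • v i)
  · rw [← h.2]; exact Equiv.sum_comp σ (fun i => s i * nsqZ (v i))

theorem jw_le_of {n : ℕ} (s : Fin n → ℤ) (hs : ∀ i, s i = 1 ∨ s i = -1) (j : ℤ × ℤ)
    (v : Fin n → ℤ × ℤ) (h : Res s j v) (k : Fin n) (hk : ∀ i, nsqZ (v i) ≤ nsqZ (v k)) :
    jw j ≤ (n : ℝ≥0∞) ^ 2 * jw (v k) := by
  have hsq : ∀ i, s i ^ 2 = 1 := by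
    intro i; rcases hs i with h | h <;> rw [h] <;> norm_num
  have h1 : j.1 ^ 2 ≤ n * ∑ i, (v i).1 ^ 2 := by
    rw [← h.1, Prod.fst_sum]
    have := sq_sum_le_card_mul_sum_sq (s := Finset.univ) (f := fun i => s i * (v i).1)
    simpa [mul_pow, hsq] using this
  have h2 : j.2 ^ 2 ≤ n * ∑ i, (v i).2 ^ 2 := by
    rw [← h.1, Prod.snd_sum]
    have := sq_sum_le_card_mul_sum_sq (s := Finset.univ) (f := fun i => s i * (v i).2)
    simpa [mul_pow, hsq] using this
  have h3 : ∑ i, nsqZ (v i) ≤ n * nsqZ (v k) := by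
    have := Finset.sum_le_card_nsmul Finset.univ (fun i => nsqZ (v i)) _ (fun i _ => hk i)
    simpa using this
  have h4 : nsqZ j ≤ n * (n * nsqZ (v k)) := by
    refine le_trans ?_ (mul_le_mul_of_nonneg_left h3 (by positivity))
    simp only [nsqZ, Finset.sum_add_distrib, mul_add]
    linarith
  have hn : (1 : ℝ) ≤ n := by
    have : 0 < n := k.pos
    exact_mod_cast this
  have h5 : (nsqZ j : ℝ) ≤ n * (n * nsqZ (v k)) := by exact_mod_cast h4
  unfold jw
  rw [← ENNReal.ofReal_natCast, ← ENNReal.ofReal_pow (by positivity),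
    ← ENNReal.ofReal_mul (by positivity)]
  apply ENNReal.ofReal_le_ofReal
  nlinarith

theorem weight_shift {n : ℕ} (hn : n ≤ 3) (y : ℤ × ℤ) (v : Fin n → ℤ × ℤ)
    (h : ∀ i, jw (v i) ≤ jw y) :
    (jw y)⁻¹ * ∏ i, (jw (v i))⁻¹ ≤ jw y ^ (-(5 / 8) : ℝ) * ∏ i, jw (v i) ^ (-(9 / 8) : ℝ) := by
  have h1 : ∀ p, (jw p)⁻¹ = jw p ^ (-(9 / 8) : ℝ) * jw p ^ (1 / 8 : ℝ) := by
    intro p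
    rw [← ENNReal.rpow_neg_one, ← ENNReal.rpow_add _ _ (jw_ne_zero p) (jw_ne_top p)]
    norm_num
  have h2 : ∏ i, (jw (v i))⁻¹ ≤ (∏ i, jw (v i) ^ (-(9 / 8) : ℝ)) * jw y ^ (3 / 8 : ℝ) := by
    simp only [h1, Finset.prod_mul_distrib]
    gcongr
    calc ∏ i, jw (v i) ^ (1 / 8 : ℝ) ≤ ∏ _i : Fin n, jw y ^ (1 / 8 : ℝ) := by
          apply Finset.prod_le_prod'
          intro i _
          exact ENNReal.rpow_le_rpow (h i) (by norm_num)
      _ = jw y ^ ((1 / 8 : ℝ) * n) := by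
          rw [ENNReal.rpow_mul]; simp
      _ ≤ jw y ^ (3 / 8 : ℝ) := by
          apply ENNReal.rpow_le_rpow_of_exponent_le (one_le_jw y)
          have : (n : ℝ) ≤ 3 := by exact_mod_cast hn
          linarith
  calc _ ≤ (jw y)⁻¹ * ((∏ i, jw (v i) ^ (-(9 / 8) : ℝ)) * jw y ^ (3 / 8 : ℝ)) := by gcongr
    _ = ((jw y)⁻¹ * jw y ^ (3 / 8 : ℝ)) * ∏ i, jw (v i) ^ (-(9 / 8) : ℝ) := by ring
    _ = _ := by
      rw [← ENNReal.rpow_neg_one, ← ENNReal.rpow_add _ _ (jw_ne_zero y) (jw_ne_top y)]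
      norm_num

theorem jw_mono {p q : ℤ × ℤ} (h : nsqZ p ≤ nsqZ q) : jw p ≤ jw q := by
  unfold jw
  apply ENNReal.ofReal_le_ofReal
  have : (nsqZ p : ℝ) ≤ nsqZ q := by exact_mod_cast h
  linarith

theorem pointwise {n : ℕ} (hn : n ≤ 3) (s : Fin (n + 2) → ℤ)
    (hs : ∀ i, s i = 1 ∨ s i = -1) (j : ℤ × ℤ) (v : Fin (n + 2) → ℤ × ℤ) (hv : Res s j v) :
    ∃ σ : Equiv.Perm (Fin (n + 2)), jw j * ∏ i, (jw (v i))⁻¹ ≤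
      Dterm (s ∘ σ) j (v ∘ σ) + Nterm (s ∘ σ) j (v ∘ σ) := by
  classical
  have e1 : (1 : Fin (n + 2)) = Fin.succ 0 := rfl
  have hprod : ∀ σ : Equiv.Perm (Fin (n + 2)), ∏ i, (jw (v i))⁻¹ =
      (jw ((v ∘ σ) 0))⁻¹ * ((jw ((v ∘ σ) 1))⁻¹ * ∏ i : Fin n, (jw ((v ∘ σ) i.succ.succ))⁻¹) := by
    intro σ
    rw [← Equiv.prod_comp σ, Fin.prod_univ_succ, Fin.prod_univ_succ]
    rfl
  by_cases hdeg : ∃ a b, a ≠ b ∧ s a + s b = 0 ∧ v a = v b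
  · obtain ⟨a, b, hab, hsab, hvab⟩ := hdeg
    obtain ⟨σ, h0, h1⟩ := exists_perm a b hab
    refine ⟨σ, le_add_right ?_⟩
    obtain ⟨r1, r2⟩ := res_perm s j v σ hv
    rw [hprod σ]
    rw [Fin.sum_univ_succ, Fin.sum_univ_succ] at r1 r2
    have hu : (v ∘ σ) 0 = (v ∘ σ) 1 := by simp [h0, h1, hvab]
    have hss : (s ∘ σ) 0 + (s ∘ σ) 1 = 0 := by simp [h0, h1, hsab]
    rw [← e1, ← hu, ← add_assoc] at r1 r2
    rw [← add_smul, hss, zero_smul, zero_add] at r1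
    rw [← add_mul, hss, zero_mul, zero_add] at r2
    rw [Dterm, if_pos ⟨hu, r1, r2⟩]
    apply le_of_eq
    ring
  · obtain ⟨a, -, ha⟩ := Finset.exists_max_image Finset.univ (fun i => nsqZ (v i))
      ⟨0, Finset.mem_univ _⟩
    obtain ⟨b, hb, hb'⟩ := Finset.exists_max_image (Finset.univ.erase a) (fun i => nsqZ (v i))
      (by
        by_cases h : a = 0
        · exact ⟨1, by simp [h]⟩
        · exact ⟨0, by simp [Ne.symm h]⟩)
    have hab : a ≠ b := by
      intro h; simp [h] at hb
    obtain ⟨σ, h0, h1⟩ := exists_perm a b hab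
    refine ⟨σ, le_add_left ?_⟩
    obtain ⟨r1, r2⟩ := res_perm s j v σ hv
    rw [hprod σ]
    rw [Fin.sum_univ_succ, Fin.sum_univ_succ, ← e1, ← add_assoc] at r1 r2
    have hsl : slice ((s ∘ σ) 0) ((s ∘ σ) 1)
        (j - ∑ i : Fin n, (s ∘ σ) i.succ.succ • (v ∘ σ) i.succ.succ)
        (nsqZ j - ∑ i : Fin n, (s ∘ σ) i.succ.succ * nsqZ ((v ∘ σ) i.succ.succ))
        ((v ∘ σ) 0) ((v ∘ σ) 1) := by
      refine ⟨eq_sub_of_add_eq r1, eq_sub_of_add_eq r2, ?_⟩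
      intro hs0 hv0
      exact hdeg ⟨a, b, hab, by simpa [h0, h1] using hs0, by simpa [h0, h1] using hv0⟩
    rw [Nterm, if_pos hsl]
    have hj := jw_le_of s hs j v hv a (fun i => ha i (Finset.mem_univ _))
    have hw := weight_shift hn ((v ∘ σ) 1) (fun i : Fin n => (v ∘ σ) i.succ.succ) (by
      intro i
      apply jw_mono
      simp only [Function.comp, h1]
      apply hb'
      simp only [Finset.mem_erase, Finset.mem_univ, and_true, ← h0]
      intro h
      have := σ.injective h
      exact absurd this (Fin.succ_ne_zero _))
    have h0' : (v ∘ σ) 0 = v a := by simp [h0]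
    rw [h0']
    calc jw j * ((jw (v a))⁻¹ * ((jw ((v ∘ σ) 1))⁻¹ * ∏ i : Fin n, (jw ((v ∘ σ) i.succ.succ))⁻¹))
        ≤ (((n + 2 : ℕ) : ℝ≥0∞) ^ 2 * jw (v a)) * ((jw (v a))⁻¹ *
          (jw ((v ∘ σ) 1) ^ (-(5 / 8) : ℝ) *
            ∏ i : Fin n, jw ((v ∘ σ) i.succ.succ) ^ (-(9 / 8) : ℝ))) := by
          gcongr
      _ = ((n + 2 : ℕ) : ℝ≥0∞) ^ 2 * (jw (v a) * (jw (v a))⁻¹) *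
          (jw ((v ∘ σ) 1) ^ (-(5 / 8) : ℝ) *
            ∏ i : Fin n, jw ((v ∘ σ) i.succ.succ) ^ (-(9 / 8) : ℝ)) := by ring
      _ = _ := by
          rw [ENNReal.mul_inv_cancel (jw_ne_zero _) (jw_ne_top _), mul_one]
          push_cast
          rfl

theorem step {n : ℕ} (hn : n ≤ 3) (h : ∃ B : ℝ≥0∞, B ≠ ⊤ ∧ CountBound n B) :
    ∃ B : ℝ≥0∞, B ≠ ⊤ ∧ CountBound (n + 2) B := by
  classical
  obtain ⟨B, hB, hC⟩ := h
  set M : ℝ≥0∞ := (∑' p : ℤ × ℤ, jw p ^ (-(9 / 8) : ℝ)) * B +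
    ((n : ℝ≥0∞) + 2) ^ 2 * ((2 * ∑' x, qw x) *
      (∑' p : ℤ × ℤ, jw p ^ (-(9 / 8) : ℝ)) ^ n) with hM
  have hMtop : M ≠ ⊤ := by
    have h1 := h_sum
    have h2 := qw_sum
    rw [hM]
    refine ENNReal.add_ne_top.2 ⟨ENNReal.mul_ne_top h1 hB, ENNReal.mul_ne_top ?_
      (ENNReal.mul_ne_top (ENNReal.mul_ne_top (by simp) h2) (ENNReal.pow_ne_top h1))⟩
    apply ENNReal.pow_ne_top
    simp
  refine ⟨∑ _σ : Equiv.Perm (Fin (n + 2)), M, by simp [ENNReal.mul_eq_top, hMtop], ?_⟩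
  intro s hs j
  calc _ ≤ ∑' v, ∑ σ : Equiv.Perm (Fin (n + 2)),
        (Dterm (s ∘ σ) j (v ∘ σ) + Nterm (s ∘ σ) j (v ∘ σ)) := by
        apply ENNReal.tsum_le_tsum
        intro v
        apply Set.indicator_apply_le
        intro hv
        obtain ⟨σ, hσ⟩ := pointwise hn s hs j v hv
        exact hσ.trans (Finset.single_le_sum
          (f := fun σ : Equiv.Perm (Fin (n + 2)) =>
            Dterm (s ∘ σ) j (v ∘ σ) + Nterm (s ∘ σ) j (v ∘ σ))
          (fun _ _ => zero_le) (Finset.mem_univ σ))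
    _ = ∑ σ : Equiv.Perm (Fin (n + 2)), ∑' v : Fin (n + 2) → ℤ × ℤ,
        (Dterm (s ∘ σ) j (v ∘ σ) + Nterm (s ∘ σ) j (v ∘ σ)) :=
        Summable.tsum_finsetSum (fun _ _ => ENNReal.summable)
    _ ≤ _ := by
        apply Finset.sum_le_sum
        intro σ _
        have := (Equiv.arrowCongr σ.symm (Equiv.refl (ℤ × ℤ))).tsum_eq
          (fun u => Dterm (s ∘ σ) j u + Nterm (s ∘ σ) j u)
        have h2 : ∀ v, (Equiv.arrowCongr σ.symm (Equiv.refl (ℤ × ℤ))) v = v ∘ σ := by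
          intro v; ext i <;> simp
        simp only [h2] at this
        rw [this, ENNReal.tsum_add]
        exact add_le_add (D_sum B hC _ (fun i => hs _) j) (N_sum _ (fun i => hs _) j)

theorem bound_one : CountBound 1 1 := by
  intro s hs j
  have key : ∀ v : Fin 1 → ℤ × ℤ, Res s j v → v = fun _ => s 0 • j := by
    intro v hv
    have h1 := hv.1
    simp only [Fin.sum_univ_one] at h1
    ext i <;> rw [Subsingleton.elim i 0, ← h1] <;> rcases hs 0 with h | h <;> simp [h]
  rw [tsum_eq_single (fun _ => s 0 • j)]
  · apply Set.indicator_apply_le (g := fun _ => (1 : ℝ≥0∞))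
    intro hv
    have : jw (s 0 • j) = jw j := by
      rcases hs 0 with h | h <;> simp [h, jw, nsqZ]
    simp only [Fin.prod_univ_one, this]
    exact ENNReal.mul_inv_le_one _
  · intro v hv
    apply Set.indicator_of_notMem
    exact fun h => hv (key v h)

/-- identification of quintuples with functions -/
def quintEquiv : Quint ≃ (Fin 5 → ℤ × ℤ) where
  toFun v := ![v.1, v.2.1, v.2.2.1, v.2.2.2.1, v.2.2.2.2]
  invFun f := (f 0, f 1, f 2, f 3, f 4)
  left_inv _ := rfl
  right_inv f := by
    funext i
    fin_cases i <;> rfl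

theorem count_quint : ∃ B : ℝ≥0∞, B ≠ ⊤ ∧ ∀ j : ℤ × ℤ,
    jw j * (∑' v : {v : Quint // isRes j v}, (jw v.1.1)⁻¹ * (jw v.1.2.1)⁻¹ * (jw v.1.2.2.1)⁻¹ *
      (jw v.1.2.2.2.1)⁻¹ * (jw v.1.2.2.2.2)⁻¹) ≤ B := by
  obtain ⟨B, hB, h'⟩ := step (n := 3) le_rfl (step (n := 1) (by norm_num) ⟨1, by simp, bound_one⟩)
  have h : CountBound 5 B := h'
  have hq : ∀ v, quintEquiv v = ![v.1, v.2.1, v.2.2.1, v.2.2.2.1, v.2.2.2.2] := fun _ => rfl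
  refine ⟨B, hB, fun j => ?_⟩
  refine le_trans (le_of_eq ?_) (h ![1, -1, 1, -1, 1] (by intro i; fin_cases i <;> simp) j)
  rw [← ENNReal.tsum_mul_left, ← quintEquiv.tsum_eq]
  have hR : ∀ v : Quint, Res ![1, -1, 1, -1, 1] j (quintEquiv v) ↔ isRes j v := by
    intro v
    simp only [Res, isRes, hq, Fin.sum_univ_five]
    simp [sub_eq_add_neg]
  refine (tsum_subtype {v : Quint | isRes j v} (fun v => jw j * ((jw v.1)⁻¹ * (jw v.2.1)⁻¹ *
    (jw v.2.2.1)⁻¹ * (jw v.2.2.2.1)⁻¹ * (jw v.2.2.2.2)⁻¹))).trans ?_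
  congr 1
  ext v
  classical
  simp only [Set.indicator, Set.mem_ofPred_eq, hR]
  congr 1
  simp [hq, Fin.prod_univ_five]

theorem cs_tsum {α : Type*} (f g : α → ℝ≥0∞) :
    (∑' a, f a * g a) ^ 2 ≤ (∑' a, f a ^ 2) * ∑' a, g a ^ 2 := by
  let : MeasurableSpace α := ⊤
  have h := ENNReal.lintegral_mul_le_Lp_mul_Lq (Measure.count : Measure α)
    Real.HolderConjugate.two_two (f := f) (g := g)
    (measurable_from_top).aemeasurable (measurable_from_top).aemeasurable
  simp only [lintegral_count, Pi.mul_apply, ENNReal.rpow_two] at h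
  refine (pow_le_pow_left₀ zero_le h 2).trans (le_of_eq ?_)
  rw [mul_pow, ← ENNReal.rpow_two, ← ENNReal.rpow_mul, ← ENNReal.rpow_two, ← ENNReal.rpow_mul]
  norm_num

theorem cs_weight {α : Type*} (w f : α → ℝ≥0∞) (hw : ∀ a, w a ≠ 0) (hw' : ∀ a, w a ≠ ⊤) :
    (∑' a, f a) ^ 2 ≤ (∑' a, (w a)⁻¹) * ∑' a, w a * f a ^ 2 := by
  have h := cs_tsum (fun a => (w a)⁻¹ ^ (1 / 2 : ℝ)) (fun a => w a ^ (1 / 2 : ℝ) * f a)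
  have e : ∀ x : ℝ≥0∞, (x ^ (1 / 2 : ℝ)) ^ 2 = x := by
    intro x
    rw [← ENNReal.rpow_two, ← ENNReal.rpow_mul]; norm_num
  have e2 : ∀ a, (w a)⁻¹ ^ (1 / 2 : ℝ) * (w a ^ (1 / 2 : ℝ) * f a) = f a := by
    intro a
    rw [← mul_assoc, ← ENNReal.mul_rpow_of_nonneg _ _ (by norm_num),
      ENNReal.inv_mul_cancel (hw a) (hw' a), ENNReal.one_rpow, one_mul]
  simpa only [e, e2, mul_pow] using h

/-- The quintic nonlinear estimate for the resonant system:
`Σ_j ⟨j⟩² (Σ_{𝓡(j)} Π_{k=1}^5 ‖u_{p_k}‖_{L⁶(ℝ×I)})² ≤ C (Σ_p ⟨p⟩² ‖u_p‖²_{L⁶(ℝ×I)})⁵`. -/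
theorem stmt_9 :
    ∃ C : ℝ≥0∞, C ≠ ⊤ ∧ ∀ (u : (ℤ × ℤ) → ℝ × ℝ → ℂ) (I : Set ℝ), I.OrdConnected →
      (∑' j : ℤ × ℤ, jw j *
          (∑' v : {v : Quint // isRes j v},
            L6 I (u v.1.1) * L6 I (u v.1.2.1) * L6 I (u v.1.2.2.1) *
              L6 I (u v.1.2.2.2.1) * L6 I (u v.1.2.2.2.2)) ^ 2)
        ≤ C * (∑' p : ℤ × ℤ, jw p * L6 I (u p) ^ 2) ^ 5 := by
  obtain ⟨B, hB, h⟩ := count_quint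
  refine ⟨B, hB, fun u I _ => ?_⟩
  set L : ℤ × ℤ → ℝ≥0∞ := fun p => L6 I (u p) with hL
  set a : ℤ × ℤ → ℝ≥0∞ := fun p => jw p * L p ^ 2 with ha
  set F : Quint → ℝ≥0∞ := fun v => a v.1 * (a v.2.1 * (a v.2.2.1 * (a v.2.2.2.1 * a v.2.2.2.2)))
    with hF
  have hj : ∀ j : ℤ × ℤ, jw j * (∑' v : {v : Quint // isRes j v},
      L v.1.1 * L v.1.2.1 * L v.1.2.2.1 * L v.1.2.2.2.1 * L v.1.2.2.2.2) ^ 2 ≤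
      B * ∑' v : {v : Quint // isRes j v}, F v.1 := by
    intro j
    have hc := cs_weight (α := {v : Quint // isRes j v})
      (fun v => jw v.1.1 * jw v.1.2.1 * jw v.1.2.2.1 * jw v.1.2.2.2.1 * jw v.1.2.2.2.2)
      (fun v => L v.1.1 * L v.1.2.1 * L v.1.2.2.1 * L v.1.2.2.2.1 * L v.1.2.2.2.2)
      (fun v => by simp [jw_ne_zero])
      (fun v => by simp [ENNReal.mul_eq_top, jw_ne_top])
    have h1 : ∀ v : {v : Quint // isRes j v},
        (jw v.1.1 * jw v.1.2.1 * jw v.1.2.2.1 * jw v.1.2.2.2.1 * jw v.1.2.2.2.2)⁻¹ =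
        (jw v.1.1)⁻¹ * (jw v.1.2.1)⁻¹ * (jw v.1.2.2.1)⁻¹ *
          (jw v.1.2.2.2.1)⁻¹ * (jw v.1.2.2.2.2)⁻¹ := by
      intro v
      rw [ENNReal.mul_inv, ENNReal.mul_inv, ENNReal.mul_inv, ENNReal.mul_inv] <;>
        simp [jw_ne_zero, jw_ne_top]
    have h2 : ∀ v : {v : Quint // isRes j v},
        (jw v.1.1 * jw v.1.2.1 * jw v.1.2.2.1 * jw v.1.2.2.2.1 * jw v.1.2.2.2.2) *
        (L v.1.1 * L v.1.2.1 * L v.1.2.2.1 * L v.1.2.2.2.1 * L v.1.2.2.2.2) ^ 2 = F v.1 := by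
      intro v
      simp only [hF, ha]
      ring
    simp only [h1, h2] at hc
    calc _ ≤ jw j * (_ * _) := by gcongr
      _ = (jw j * _) * _ := (mul_assoc _ _ _).symm
      _ ≤ _ := by gcongr; exact h j
  calc _ ≤ ∑' j, B * ∑' v : {v : Quint // isRes j v}, F v.1 := ENNReal.tsum_le_tsum hj
    _ = B * ∑' j, ∑' v : {v : Quint // isRes j v}, F v.1 := ENNReal.tsum_mul_left
    _ ≤ B * ∑' v : Quint, F v := by
        gcongr
        rw [← ENNReal.tsum_sigma' (fun x : (Σ j : ℤ × ℤ, {v : Quint // isRes j v}) => F x.2.1)]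
        apply ENNReal.tsum_comp_le_tsum_of_injective
          (f := fun x : (Σ j : ℤ × ℤ, {v : Quint // isRes j v}) => x.2.1) _ F
        rintro ⟨j, v, hv⟩ ⟨j', v', hv'⟩ hh
        simp only at hh
        subst hh
        obtain rfl : j = j' := hv.1.symm.trans hv'.1
        rfl
    _ = _ := by
        simp only [hF, tsum_prod_any, ENNReal.tsum_mul_left, ENNReal.tsum_mul_right]
        ring
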